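/- (Pessimistic MDP never over-estimates the true value; step in the proof of Theorem 1.) Let M be an MDP with rewards in [−Rmax, Rmax] and discount γ ∈ [0,1), let U ⊆ S × A be any set of state-action pairs, and let M_p be the (U, Rmax)-true-dynamics pessimistic MDP: from any (s,a) ∈ U and from the absorbing state HALT every action leads to HALT with probability 1, from all other pairs transitions follow the true kernel P(·|s,a), the reward is −Rmax at HALT and r(s,a) otherwise, and the initial distribution is ρ0. Then for any policy π: J_{ρ0}(π, M_p) ≤ J_{ρ0}(π, M). -/

import Mathlib

open scoped ENNReal NNReal
open Classical

namespace MOReL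

universe u v

variable {S : Type u} {A : Type v}

/-- Distribution over trajectory prefixes `(s_0,a_0),…,(s_n,a_n)` generated by executing
policy `π` in the MDP with transition kernel `P` starting from `ρ0`. -/
noncomputable def pathPMF (ρ0 : PMF S) (π : S → PMF A) (P : S → A → PMF S) :
    (n : ℕ) → PMF (Fin (n + 1) → S × A)
  | 0 => ρ0.bind fun s => (π s).map fun a => fun _ => (s, a)
  | n + 1 =>
      (pathPMF ρ0 π P n).bind fun p =>
        (P (p (Fin.last n)).1 (p (Fin.last n)).2).bind fun s' =>
          (π s').map fun a' => Fin.snoc p (s', a')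

/-- Marginal distribution of `(s_t, a_t)`. -/
noncomputable def saDist (ρ0 : PMF S) (π : S → PMF A) (P : S → A → PMF S) (t : ℕ) :
    PMF (S × A) :=
  (pathPMF ρ0 π P t).map fun p => p (Fin.last t)

/-- Expectation of a real-valued function under a PMF. -/
noncomputable def pexp {α : Type*} (μ : PMF α) (f : α → ℝ) : ℝ :=
  ∑' x, (μ x).toReal * f x

/-- The value `J_{ρ0}(π, M) = E[∑_t γ^t r(s_t,a_t)]`. -/
noncomputable def J (ρ0 : PMF S) (π : S → PMF A) (P : S → A → PMF S) (γ : ℝ)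
    (r : S → A → ℝ) : ℝ :=
  ∑' t : ℕ, γ ^ t * pexp (saDist ρ0 π P t) (fun sa => r sa.1 sa.2)

/-- `P(T_V^π = t)`: the probability that the first visit of the executed trajectory to the
state-action set `V` occurs at time `t`. -/
noncomputable def hitProb (ρ0 : PMF S) (π : S → PMF A) (P : S → A → PMF S)
    (V : Set (S × A)) (t : ℕ) : ℝ≥0∞ :=
  (pathPMF ρ0 π P t).toOuterMeasure
    {p | p (Fin.last t) ∈ V ∧ ∀ i : Fin (t + 1), (i : ℕ) < t → p i ∉ V}

/-- `E[γ^{T_V^π}]`, with the convention `γ^∞ = 0`. -/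
noncomputable def discHit (ρ0 : PMF S) (π : S → PMF A) (P : S → A → PMF S) (γ : ℝ)
    (V : Set (S × A)) : ℝ :=
  ∑' t : ℕ, γ ^ t * (hitProb ρ0 π P V t).toReal

/-- Total variation distance between two PMFs. -/
noncomputable def DTV {α : Type*} (p q : PMF α) : ℝ :=
  (1 / 2) * ∑' x, |(p x).toReal - (q x).toReal|

/-- Discounted state-action visitation distribution `d^{π,M}(s,a)`. -/
noncomputable def dVisit (ρ0 : PMF S) (π : S → PMF A) (P : S → A → PMF S) (γ : ℝ)
    (sa : S × A) : ℝ :=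
  (1 - γ) * ∑' t : ℕ, γ ^ t * ((saDist ρ0 π P t) sa).toReal

/-- `d^{π,M}(V)` for a set `V` of state-action pairs. -/
noncomputable def dVisitSet (ρ0 : PMF S) (π : S → PMF A) (P : S → A → PMF S) (γ : ℝ)
    (V : Set (S × A)) : ℝ :=
  ∑' sa : V, dVisit ρ0 π P γ sa

/-- The set of `α`-unknown state-action pairs. -/
def unknown (P Phat : S → A → PMF S) (α : ℝ) : Set (S × A) :=
  {sa | α < DTV (Phat sa.1 sa.2) (P sa.1 sa.2)}

/-- Transition kernel of the pessimistic MDP on `Option S` (`none` is the absorbing state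
HALT): unknown pairs and HALT transition to HALT, known pairs follow `Phat`. -/
noncomputable def pessKernel (Phat : S → A → PMF S) (U : Set (S × A)) :
    Option S → A → PMF (Option S) := fun s a =>
  match s with
  | none => PMF.pure none
  | some s => if (s, a) ∈ U then PMF.pure none else (Phat s a).map some

/-- Reward of the pessimistic MDP: `-κ` at HALT and `r` elsewhere. -/
def pessReward (r : S → A → ℝ) (κ : ℝ) : Option S → A → ℝ := fun s a =>
  match s with
  | none => -κ
  | some s => r s a

/-- Extend a policy on `S` to `Option S` by an arbitrary action distribution at HALT
(the pessimistic value does not depend on this choice). -/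
def extendPolicy (π : S → PMF A) (a0 : PMF A) : Option S → PMF A := fun s =>
  match s with
  | none => a0
  | some s => π s

end MOReL

namespace MOReL

/-- The joint law of a state drawn from `μ` and an action drawn from `π` at that state. -/
noncomputable def stateActionPMF {S : Type u} {A : Type v} (μ : PMF S) (π : S → PMF A) :
    PMF (S × A) :=
  μ.bind fun s => (π s).map (Prod.mk s)

lemma stateActionPMF_apply {S : Type u} {A : Type v} (μ : PMF S) (π : S → PMF A)
    (s : S) (a : A) : stateActionPMF μ π (s, a) = μ s * π s a := by
  rw [stateActionPMF, PMF.bind_apply, tsum_eq_single s]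
  · rw [PMF.map_apply, tsum_eq_single a]
    · simp
    · intro b hb
      simp [hb.symm]
  · intro s' hs
    simp [PMF.map_apply, hs.symm]

lemma saDist_zero {S : Type u} {A : Type v} (ρ0 : PMF S) (π : S → PMF A)
    (P : S → A → PMF S) : saDist ρ0 π P 0 = stateActionPMF ρ0 π := by
  simp only [saDist, pathPMF, stateActionPMF, PMF.map_bind, PMF.map_comp]
  rfl

lemma saDist_succ {S : Type u} {A : Type v} (ρ0 : PMF S) (π : S → PMF A)
    (P : S → A → PMF S) (t : ℕ) :
    saDist ρ0 π P (t + 1) =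
      (saDist ρ0 π P t).bind fun x => stateActionPMF (P x.1 x.2) π := by
  simp only [saDist, pathPMF, stateActionPMF, PMF.map_bind, PMF.map_comp, PMF.bind_map]
  refine congrArg _ (funext fun p => congrArg _ (funext fun s' => ?_))
  congr 1
  funext a'
  simp

lemma some_prodMap_injective {S : Type u} {A : Type v} :
    Function.Injective (Prod.map some id : S × A → Option S × A) :=
  (Option.some_injective S).prodMap Function.injective_id

/-- A sum over `Option S × A` of a function vanishing at `none` is a sum over `S × A`. -/
lemma tsum_option_prod {S : Type u} {A : Type v} {β : Type*} [AddCommMonoid β]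
    [TopologicalSpace β] (f : Option S × A → β) (hf : ∀ a, f (none, a) = 0) :
    ∑' x, f x = ∑' x : S × A, f (some x.1, x.2) := by
  refine (some_prodMap_injective.tsum_eq ?_).symm
  rintro ⟨_ | s, a⟩ hx
  · exact absurd (hf a) hx
  · exact ⟨(s, a), rfl⟩

lemma pessKernel_some_le {S : Type u} {A : Type v} (P : S → A → PMF S) (U : Set (S × A))
    (s : S) (a : A) (s' : S) : pessKernel P U (some s) a (some s') ≤ P s a s' := by
  by_cases h : (s, a) ∈ U
  · simp [pessKernel, h]
  · simp [pessKernel, h]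

/-- Away from HALT, the state-action law of the pessimistic MDP is dominated by that of the
original MDP. -/
lemma saDist_pessKernel_le {S : Type u} {A : Type v} (P : S → A → PMF S) (ρ0 : PMF S)
    (U : Set (S × A)) (π : S → PMF A) (a0 : PMF A) (t : ℕ) (s : S) (a : A) :
    saDist (ρ0.map some) (extendPolicy π a0) (pessKernel P U) t (some s, a)
      ≤ saDist ρ0 π P t (s, a) := by
  induction t generalizing s a with
  | zero => simp [saDist_zero, stateActionPMF_apply, extendPolicy]
  | succ t ih =>
    simp only [saDist_succ, PMF.bind_apply, stateActionPMF_apply]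
    rw [tsum_option_prod _ (fun b => by simp [pessKernel])]
    refine ENNReal.tsum_le_tsum fun x => ?_
    exact mul_le_mul' (ih x.1 x.2) (mul_le_mul' (pessKernel_some_le P U _ _ _) le_rfl)

lemma summable_toReal_pmf {α : Type*} (μ : PMF α) : Summable fun x => (μ x).toReal :=
  ENNReal.summable_toReal μ.tsum_coe_ne_top

lemma tsum_toReal_pmf {α : Type*} (μ : PMF α) : ∑' x, (μ x).toReal = 1 := by
  rw [← ENNReal.tsum_toReal_eq μ.apply_ne_top, μ.tsum_coe, ENNReal.toReal_one]

lemma summable_toReal_mul_of_bounded {α : Type*} (μ : PMF α) {f : α → ℝ} {C : ℝ}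
    (hf : ∀ x, |f x| ≤ C) : Summable fun x => (μ x).toReal * f x := by
  refine Summable.of_norm_bounded ((summable_toReal_pmf μ).mul_right C) fun x => ?_
  rw [Real.norm_eq_abs, abs_mul, abs_of_nonneg ENNReal.toReal_nonneg]
  exact mul_le_mul_of_nonneg_left (hf x) ENNReal.toReal_nonneg

lemma abs_pexp_le {α : Type*} (μ : PMF α) {f : α → ℝ} {C : ℝ}
    (hf : ∀ x, |f x| ≤ C) : |pexp μ f| ≤ C := by
  have h : ‖∑' x, (μ x).toReal * f x‖ ≤ ∑' x, (μ x).toReal * C := by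
    refine tsum_of_norm_bounded ((summable_toReal_pmf μ).mul_right C).hasSum fun x => ?_
    rw [Real.norm_eq_abs, abs_mul, abs_of_nonneg ENNReal.toReal_nonneg]
    exact mul_le_mul_of_nonneg_left (hf x) ENNReal.toReal_nonneg
  rwa [tsum_mul_right, tsum_toReal_pmf, one_mul] at h

lemma tsum_toReal_mul_add_const {α : Type*} (μ : PMF α) {f : α → ℝ} {C : ℝ}
    (hf : ∀ x, |f x| ≤ C) (c : ℝ) :
    ∑' x, (μ x).toReal * (f x + c) = pexp μ f + c := by
  simp only [mul_add, pexp]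
  rw [(summable_toReal_mul_of_bounded μ hf).tsum_add ((summable_toReal_pmf μ).mul_right c),
    tsum_mul_right, tsum_toReal_pmf, one_mul]

lemma summable_discounted_pexp {S : Type u} {A : Type v} (ρ0 : PMF S) (π : S → PMF A)
    (P : S → A → PMF S) {γ : ℝ} (hγ0 : 0 ≤ γ) (hγ1 : γ < 1) {r : S → A → ℝ} {C : ℝ}
    (hr : ∀ s a, |r s a| ≤ C) :
    Summable fun t : ℕ => γ ^ t * pexp (saDist ρ0 π P t) (fun sa => r sa.1 sa.2) := by
  refine Summable.of_norm_bounded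
    ((summable_geometric_of_lt_one hγ0 hγ1).mul_right C) fun t => ?_
  rw [Real.norm_eq_abs, abs_mul, abs_of_nonneg (pow_nonneg hγ0 t)]
  exact mul_le_mul_of_nonneg_left (abs_pexp_le _ fun x => hr x.1 x.2) (pow_nonneg hγ0 t)

lemma abs_pessReward_le {S : Type u} {A : Type v} {r : S → A → ℝ} {C : ℝ} (hC : 0 ≤ C)
    (hr : ∀ s a, |r s a| ≤ C) (s : Option S) (a : A) : |pessReward r C s a| ≤ C := by
  cases s with
  | none => simp [pessReward, abs_of_nonneg hC]
  | some s => exact hr s a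

lemma pexp_pessReward_le {S : Type u} {A : Type v} {r : S → A → ℝ} {C : ℝ} (hC : 0 ≤ C)
    (hr : ∀ s a, |r s a| ≤ C) (μ : PMF (Option S × A)) (ν : PMF (S × A))
    (h : ∀ s a, μ (some s, a) ≤ ν (s, a)) :
    pexp μ (fun x => pessReward r C x.1 x.2) ≤ pexp ν (fun x => r x.1 x.2) := by
  have hp : ∀ x : Option S × A, |pessReward r C x.1 x.2| ≤ C :=
    fun x => abs_pessReward_le hC hr x.1 x.2
  have hr' : ∀ x : S × A, |r x.1 x.2| ≤ C := fun x => hr x.1 x.2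
  rw [← add_le_add_iff_right C, ← tsum_toReal_mul_add_const μ hp,
    ← tsum_toReal_mul_add_const ν hr', tsum_option_prod _ (fun a => by simp [pessReward])]
  have hsum : Summable fun x => (ν x).toReal * (r x.1 x.2 + C) := by
    simp only [mul_add]
    exact (summable_toReal_mul_of_bounded ν hr').add ((summable_toReal_pmf ν).mul_right C)
  have hnn : ∀ x : S × A, 0 ≤ r x.1 x.2 + C := fun x => by
    linarith [(abs_le.mp (hr' x)).1]
  have hle : ∀ x : S × A, (μ (some x.1, x.2)).toReal * (r x.1 x.2 + C)
      ≤ (ν x).toReal * (r x.1 x.2 + C) := fun x =>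
    mul_le_mul_of_nonneg_right (ENNReal.toReal_mono (ν.apply_ne_top x) (h x.1 x.2)) (hnn x)
  exact (hsum.of_nonneg_of_le
    (fun x => mul_nonneg ENNReal.toReal_nonneg (hnn x)) hle).tsum_le_tsum hle hsum

/-- **Step in the proof of Theorem 1.** The true-dynamics pessimistic MDP never
over-estimates the true value. -/
theorem true_pessimistic_upper_bound
    {S : Type u} {A : Type v} [Countable S] [Countable A]
    (P : S → A → PMF S) (ρ0 : PMF S)
    (r : S → A → ℝ) (Rmax : ℝ) (hR : ∀ s a, |r s a| ≤ Rmax)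
    (γ : ℝ) (hγ0 : 0 ≤ γ) (hγ1 : γ < 1)
    (U : Set (S × A))
    (π : S → PMF A) (a0 : PMF A) :
    J (ρ0.map some) (extendPolicy π a0) (pessKernel P U) γ (pessReward r Rmax)
      ≤ J ρ0 π P γ r := by
  obtain ⟨s, -⟩ := ρ0.support_nonempty
  obtain ⟨a, -⟩ := a0.support_nonempty
  have hC : 0 ≤ Rmax := (abs_nonneg _).trans (hR s a)
  refine (summable_discounted_pexp _ _ _ hγ0 hγ1 (abs_pessReward_le hC hR)).tsum_le_tsum
    (fun t => ?_) (summable_discounted_pexp _ _ _ hγ0 hγ1 hR)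
  exact mul_le_mul_of_nonneg_left
    (pexp_pessReward_le hC hR _ _ (saDist_pessKernel_le P ρ0 U π a0 t)) (pow_nonneg hγ0 t)

end MOReL
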